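/- For every m ≥ 2 and every γ, δ, κ with m ≤ δ ≤ 2m and 1 ≤ κ ≤ γ ≤ 2m−δ+1, there exist two additive extended perfect codes C₁ and C₂ with α = 2^m and β = 2^(2m−1)−2^(m−1) (binary length 2^(2m)), both of dual type (2^m, 2^(2m−1)−2^(m−1); 1, m), such that C₁ ∩ C₂ is of dual type (2^m, 2^(2m−1)−2^(m−1); γ, δ; κ). -/

import Mathlib

open scoped BigOperators

/-- `Z2` is the ring of integers modulo 2. -/
abbrev Z2 : Type := ZMod 2

/-- `Z4` is the ring of integers modulo 4. -/
abbrev Z4 : Type := ZMod 4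

/-- The ambient group `Z₂^α × Z₄^β` for additive codes. -/
abbrev Amb (α β : ℕ) : Type := (Fin α → Z2) × (Fin β → Z4)

/-- The inner product on `Z₂^α × Z₄^β`:
`⟨u,v⟩ = 2·(Σᵢ ūᵢ·v̄ᵢ) + Σⱼ uⱼ·vⱼ ∈ Z₄`, where the bar denotes the lift `0 ↦ 0`, `1 ↦ 1`
of binary coordinates into `Z₄`. -/
def addInner {α β : ℕ} (u v : Amb α β) : Z4 :=
  2 * (∑ i, ((u.1 i).val : Z4) * ((v.1 i).val : Z4)) + ∑ j, u.2 j * v.2 j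

lemma addInner_zero_left {α β : ℕ} (v : Amb α β) : addInner 0 v = 0 := by
  simp [addInner]

lemma addInner_add_left {α β : ℕ} (u u' v : Amb α β) :
    addInner (u + u') v = addInner u v + addInner u' v := by
  have key : ∀ x x' y : Z2,
      (2 : Z4) * ((((x + x').val : ℕ) : Z4) * ((y.val : ℕ) : Z4)) =
        2 * (((x.val : ℕ) : Z4) * ((y.val : ℕ) : Z4)) +
          2 * (((x'.val : ℕ) : Z4) * ((y.val : ℕ) : Z4)) := by decide
  simp only [addInner, Prod.fst_add, Prod.snd_add, Pi.add_apply, add_mul,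
    Finset.mul_sum, Finset.sum_add_distrib]
  rw [Finset.sum_congr rfl (fun i _ => key (u.1 i) (u'.1 i) (v.1 i)),
    Finset.sum_add_distrib]
  ring

lemma addInner_neg_left {α β : ℕ} (u v : Amb α β) :
    addInner (-u) v = - addInner u v := by
  have hn : ∀ x : Z2, (-x) = x := by decide
  have key : ∀ S T : Z4, 2 * S + -T = -(2 * S + T) := by decide
  simp only [addInner, Prod.fst_neg, Prod.snd_neg, Pi.neg_apply, hn, neg_mul]
  rw [Finset.sum_neg_distrib]
  exact key _ _

/-- The additive dual `C^⊥ = {u : ⟨u,v⟩ = 0 for all v ∈ C}` of an additive code `C`. -/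
def dualCode {α β : ℕ} (C : AddSubgroup (Amb α β)) : AddSubgroup (Amb α β) where
  carrier := {u | ∀ v ∈ C, addInner u v = 0}
  zero_mem' := fun v _ => addInner_zero_left v
  add_mem' := by
    intro a b ha hb v hv
    rw [addInner_add_left, ha v hv, hb v hv, add_zero]
  neg_mem' := by
    intro a ha v hv
    rw [addInner_neg_left, ha v hv, neg_zero]

/-- An additive code `C ⊆ Z₂^α × Z₄^β` is of type `(α,β;γ,δ)` when it is isomorphic,
as an abelian group, to `Z₂^γ × Z₄^δ`; equivalently (which is how we state it),
`|C| = 2^(γ+2δ)` and the number of elements `x ∈ C` with `x + x = 0` is `2^(γ+δ)`. -/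
def isOfType {α β : ℕ} (C : AddSubgroup (Amb α β)) (γ δ : ℕ) : Prop :=
  Nat.card C = 2 ^ (γ + 2 * δ) ∧
    Nat.card {x : Amb α β // x ∈ C ∧ x + x = 0} = 2 ^ (γ + δ)

/-- An additive code `C` is of type `(α,β;γ,δ;κ)` when it is of type `(α,β;γ,δ)` and
`2^κ` is the cardinality of the image of `{x ∈ C : x + x = 0}` under the projection
onto the binary coordinates. -/
def isOfTypeK {α β : ℕ} (C : AddSubgroup (Amb α β)) (γ δ κ : ℕ) : Prop :=
  isOfType C γ δ ∧
    Nat.card ↥(Prod.fst '' {x : Amb α β | x ∈ C ∧ x + x = 0}) = 2 ^ κ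

/-- The Gray map on one quaternary coordinate:
`0 ↦ (0,0)`, `1 ↦ (0,1)`, `2 ↦ (1,1)`, `3 ↦ (1,0)`. -/
def grayPhi (y : Z4) : Z2 × Z2 :=
  if y = 0 then (0, 0) else if y = 1 then (0, 1) else if y = 2 then (1, 1) else (1, 0)

/-- The Gray map `Φ : Z₂^α × Z₄^β → Z₂^(α+2β)` (with index set `Fin α ⊕ Fin β × Fin 2`),
acting as the identity on the binary coordinates and as `grayPhi` coordinatewise on the
quaternary coordinates. -/
def grayMap {α β : ℕ} (u : Amb α β) : (Fin α ⊕ Fin β × Fin 2) → Z2 :=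
  Sum.elim (fun a => u.1 a)
    (fun b => if b.2 = 0 then (grayPhi (u.2 b.1)).1 else (grayPhi (u.2 b.1)).2)

/-- The minimum Hamming distance of a binary code `S` equals `d`. -/
def minDistEq {ι : Type} [Fintype ι] (S : Set (ι → Z2)) (d : ℕ) : Prop :=
  (∀ x ∈ S, ∀ y ∈ S, x ≠ y → d ≤ hammingDist x y) ∧
    ∃ x ∈ S, ∃ y ∈ S, x ≠ y ∧ hammingDist x y = d

/-- A quaternary linear perfect code of length `β = 2^(t-1)` (`t ≥ 3`): an additive
subgroup of `Z₄^β` whose Gray image has cardinality `2^(2β-t-1)` and minimum Hamming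
distance `4`. -/
def isQuatPerfect (t β : ℕ) (C : AddSubgroup (Amb 0 β)) : Prop :=
  3 ≤ t ∧ β = 2 ^ (t - 1) ∧
    Nat.card ↥(grayMap '' (C : Set (Amb 0 β))) = 2 ^ (2 * β - t - 1) ∧
    minDistEq (grayMap '' (C : Set (Amb 0 β))) 4

/-- An additive extended perfect code with `α ≠ 0` and binary length `α + 2β = 2^t`:
an additive subgroup of `Z₂^α × Z₄^β` with `α ≥ 1` whose Gray image has cardinality
`2^(2^t - t - 1)` and minimum Hamming distance `4`. -/
def isAddExtPerfect (t α β : ℕ) (C : AddSubgroup (Amb α β)) : Prop :=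
  1 ≤ α ∧ α + 2 * β = 2 ^ t ∧
    Nat.card ↥(grayMap '' (C : Set (Amb α β))) = 2 ^ (2 ^ t - t - 1) ∧
    minDistEq (grayMap '' (C : Set (Amb α β))) 4

lemma addInner_comm {α β : ℕ} (u v : Amb α β) : addInner u v = addInner v u := by
  simp only [addInner, mul_comm]

lemma exists_addInner_ne_zero {α β : ℕ} {v : Amb α β} (hv : v ≠ 0) :
    ∃ u, addInner u v ≠ 0 := by
  by_contra! h
  apply hv
  refine Prod.ext (funext fun i => ?_) (funext fun j => ?_)
  · have h1 := h (Pi.single i 1, 0)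
    have key : ∀ x : Z2, (2 : Z4) * ((x.val : ℕ) : Z4) = 0 → x = 0 := by decide
    apply key
    rw [← h1, addInner, Finset.sum_eq_single i]
    · simp [ZMod.val_one]
    · intro b _ hb
      simp [Pi.single_eq_of_ne hb]
    · simp
  · have h1 := h (0, Pi.single j 1)
    simpa [addInner, Pi.single_apply] using h1

/-- The additive character `v ↦ i^⟨u,v⟩` of `Z₂^α × Z₄^β`. -/
noncomputable def innerChar {α β : ℕ} (u : Amb α β) : AddChar (Amb α β) ℂ where
  toFun v := ZMod.stdAddChar (addInner v u)
  map_zero_eq_one' := by simp [addInner_zero_left]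
  map_add_eq_mul' := by
    intro v w
    rw [addInner_add_left, AddChar.map_add_eq_mul]

lemma innerChar_apply {α β : ℕ} (u v : Amb α β) :
    innerChar u v = ZMod.stdAddChar (addInner v u) := rfl

lemma innerChar_eq_one_iff {α β : ℕ} (u v : Amb α β) :
    innerChar u v = 1 ↔ addInner v u = 0 := by
  rw [innerChar_apply, ← (ZMod.stdAddChar (N := 4)).map_zero_eq_one,
    ZMod.injective_stdAddChar.eq_iff]

lemma card_mul_card_dualCode {α β : ℕ} (C : AddSubgroup (Amb α β)) :
    Nat.card C * Nat.card (dualCode C) = Nat.card (Amb α β) := by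
  classical
  have h1 : ∑ u : Amb α β, ∑ v : C, innerChar u (v : Amb α β) =
      (Nat.card C * Nat.card (dualCode C) : ℕ) := by
    have hrow : ∀ u : Amb α β, ∑ v : C, innerChar u (v : Amb α β) =
        if u ∈ dualCode C then (Nat.card C : ℂ) else 0 := by
      intro u
      have := ((innerChar u).compAddMonoidHom C.subtype).sum_eq_ite
      simp only [AddChar.compAddMonoidHom_apply, AddSubgroup.subtype_apply] at this
      rw [this, Nat.card_eq_fintype_card]
      congr 1
      rw [AddChar.eq_zero_iff]
      simp only [AddChar.compAddMonoidHom_apply, AddSubgroup.subtype_apply,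
        innerChar_eq_one_iff, Subtype.forall, eq_iff_iff]
      exact forall₂_congr fun v _ => by rw [addInner_comm]
    simp_rw [hrow]
    rw [← Finset.sum_filter, Finset.sum_const, nsmul_eq_mul, mul_comm, Nat.cast_mul]
    congr 2
    rw [Nat.card_eq_fintype_card, Fintype.card_subtype]
  have h2 : ∑ u : Amb α β, ∑ v : C, innerChar u (v : Amb α β) =
      (Nat.card (Amb α β) : ℕ) := by
    rw [Finset.sum_comm]
    have hcol : ∀ v : C, ∑ u : Amb α β, innerChar u (v : Amb α β) =
        if v = 0 then (Nat.card (Amb α β) : ℂ) else 0 := by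
      intro v
      have := (innerChar (v : Amb α β)).sum_eq_ite
      simp only [innerChar_apply] at this ⊢
      simp_rw [addInner_comm (v : Amb α β)]
      rw [this, Nat.card_eq_fintype_card]
      congr 1
      rw [AddChar.eq_zero_iff]
      simp only [innerChar_eq_one_iff, eq_iff_iff]
      constructor
      · intro h
        by_contra hv
        obtain ⟨u, hu⟩ := exists_addInner_ne_zero (v := (v : Amb α β)) (by simpa using hv)
        exact hu (h u)
      · rintro rfl u
        rw [addInner_comm]
        exact addInner_zero_left u
    simp_rw [hcol]
    simp
  exact_mod_cast h1.symm.trans h2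

lemma dualCode_dualCode {α β : ℕ} (C : AddSubgroup (Amb α β)) :
    dualCode (dualCode C) = C := by
  symm
  have hle : C ≤ dualCode (dualCode C) := fun v hv u hu => by
    rw [addInner_comm]
    exact hu v hv
  apply AddSubgroup.eq_of_le_of_card_ge hle
  have h1 := card_mul_card_dualCode C
  have h2 := card_mul_card_dualCode (dualCode C)
  rw [← h1, mul_comm] at h2
  exact (Nat.eq_of_mul_eq_mul_right Nat.card_pos h2).le

lemma dualCode_sup {α β : ℕ} (C D : AddSubgroup (Amb α β)) :
    dualCode (C ⊔ D) = dualCode C ⊓ dualCode D := by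
  refine le_antisymm (le_inf ?_ ?_) ?_
  · exact fun u hu v hv => hu v (le_sup_left (b := D) hv)
  · exact fun u hu v hv => hu v (le_sup_right (a := C) hv)
  · rintro u ⟨hC, hD⟩ v hv
    obtain ⟨c, hc, d, hd, rfl⟩ := AddSubgroup.mem_sup.1 hv
    rw [addInner_comm, addInner_add_left, addInner_comm c, addInner_comm d, hC c hc, hD d hd,
      add_zero]

lemma mem_dualCode_closure {α β : ℕ} {s : Set (Amb α β)} {u : Amb α β} :
    u ∈ dualCode (AddSubgroup.closure s) ↔ ∀ v ∈ s, addInner u v = 0 := by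
  constructor
  · exact fun h v hv => h v (AddSubgroup.subset_closure hv)
  · intro h v hv
    rw [addInner_comm]
    induction hv using AddSubgroup.closure_induction with
    | mem w hw => rw [addInner_comm, h w hw]
    | zero => exact addInner_zero_left u
    | add w w' _ _ hw hw' => rw [addInner_add_left, hw, hw', add_zero]
    | neg w _ hw => rw [addInner_neg_left, hw, neg_zero]

lemma zmod_val_add_nsmul {n : ℕ} [NeZero n] {G : Type*} [AddCommGroup G] {w : G}
    (hw : n • w = 0) (a b : ZMod n) : (a + b).val • w = a.val • w + b.val • w := by
  rw [← add_nsmul, ZMod.val_add]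
  conv_rhs => rw [← Nat.mod_add_div (a.val + b.val) n, add_nsmul, mul_comm, mul_nsmul', hw]
  simp

lemma Amb.four_nsmul {α β : ℕ} (w : Amb α β) : 4 • w = 0 := by
  have h2 : ∀ x : Z2, 4 • x = 0 := by decide
  have h4 : ∀ x : Z4, 4 • x = 0 := by decide
  exact Prod.ext (funext fun i => h2 _) (funext fun j => h4 _)

/-- The homomorphism `Z₂^A × Z₂^B → Z₂^α × Z₄^β` sending `(a,b)` to
`∑ aᵢ • 2wᵢ + ∑ bⱼ • zⱼ`. -/
def torsionHom {α β : ℕ} {A B : Type*} [Fintype A] [Fintype B] (w : A → Amb α β)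
    (z : B → Amb α β) (hz : ∀ b, 2 • z b = 0) : (A → Z2) × (B → Z2) →+ Amb α β :=
  AddMonoidHom.mk' (fun c => ∑ i, (c.1 i).val • (2 • w i) + ∑ j, (c.2 j).val • z j) (by
    intro c d
    have hw : ∀ i, 2 • (2 • w i) = 0 := fun i => by
      rw [← mul_nsmul]; exact Amb.four_nsmul (w i)
    simp only [Prod.fst_add, Prod.snd_add, Pi.add_apply, zmod_val_add_nsmul (hw _),
      zmod_val_add_nsmul (hz _), Finset.sum_add_distrib]
    abel)

/-- The homomorphism `Z₄^A × Z₂^B → Z₂^α × Z₄^β` sending `(a,b)` to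
`∑ aᵢ • wᵢ + ∑ bⱼ • zⱼ`. -/
def generatorHom {α β : ℕ} {A B : Type*} [Fintype A] [Fintype B] (w : A → Amb α β)
    (z : B → Amb α β) (hz : ∀ b, 2 • z b = 0) : (A → Z4) × (B → Z2) →+ Amb α β :=
  AddMonoidHom.mk' (fun c => ∑ i, (c.1 i).val • w i + ∑ j, (c.2 j).val • z j) (by
    intro c d
    simp only [Prod.fst_add, Prod.snd_add, Pi.add_apply,
      zmod_val_add_nsmul (Amb.four_nsmul (w _)), zmod_val_add_nsmul (hz _),
      Finset.sum_add_distrib]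
    abel)

section Generators

variable {α β : ℕ} {A B : Type*} [Fintype A] [Fintype B] {w : A → Amb α β}
  {z : B → Amb α β} (hz : ∀ b, 2 • z b = 0)

lemma torsionHom_apply (c : (A → Z2) × (B → Z2)) :
    torsionHom w z hz c = ∑ i, (c.1 i).val • (2 • w i) + ∑ j, (c.2 j).val • z j := rfl

lemma generatorHom_apply (c : (A → Z4) × (B → Z2)) :
    generatorHom w z hz c = ∑ i, (c.1 i).val • w i + ∑ j, (c.2 j).val • z j := rfl

lemma range_generatorHom :
    (generatorHom w z hz).range = AddSubgroup.closure (Set.range w ∪ Set.range z) := by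
  classical
  apply le_antisymm
  · rintro _ ⟨c, rfl⟩
    rw [generatorHom_apply]
    refine add_mem (sum_mem fun i _ => nsmul_mem ?_ _) (sum_mem fun j _ => nsmul_mem ?_ _)
    · exact AddSubgroup.subset_closure (Or.inl ⟨i, rfl⟩)
    · exact AddSubgroup.subset_closure (Or.inr ⟨j, rfl⟩)
  · rw [AddSubgroup.closure_le]
    rintro _ (⟨i, rfl⟩ | ⟨j, rfl⟩)
    · refine ⟨(Pi.single i 1, 0), ?_⟩
      rw [generatorHom_apply, Finset.sum_eq_single i]
      · simp [ZMod.val_one'' (show 4 ≠ 1 by decide)]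
      · intro k _ hk
        simp [Pi.single_eq_of_ne hk]
      · simp
    · refine ⟨(0, Pi.single j 1), ?_⟩
      rw [generatorHom_apply, Finset.sum_eq_single (s := Finset.univ) (a := j)]
      · simp [ZMod.val_one'' (show 2 ≠ 1 by decide)]
      · intro k _ hk
        simp [Pi.single_eq_of_ne hk]
      · simp

lemma two_nsmul_generatorHom (c : (A → Z4) × (B → Z2)) :
    2 • generatorHom w z hz c =
      torsionHom w z hz (fun i => ZMod.castHom (show 2 ∣ 4 by decide) Z2 (c.1 i), 0) := by
  have key : ∀ a : Z4, ∀ v : Amb α β,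
      2 • (a.val • v) = (ZMod.castHom (show 2 ∣ 4 by decide) Z2 a).val • (2 • v) := by
    intro a v
    have : ∀ a : Z4, 2 * a.val % 4 =
      2 * (ZMod.castHom (show 2 ∣ 4 by decide) Z2 a).val % 4 := by decide
    have ha := this a
    rw [← mul_nsmul', ← mul_nsmul]
    rw [← Nat.mod_add_div (2 * a.val) 4, ha]
    conv_rhs => rw [← Nat.mod_add_div (2 * _) 4]
    simp only [add_nsmul, mul_nsmul, Amb.four_nsmul]
    simp
  rw [generatorHom_apply, torsionHom_apply, nsmul_add, Finset.smul_sum, Finset.smul_sum]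
  congr 1
  · exact Finset.sum_congr rfl fun i _ => key _ _
  · simp only [Pi.zero_apply, ZMod.val_zero, zero_nsmul]
    congr 1
    funext j
    rw [← mul_nsmul', mul_comm, mul_nsmul', hz, nsmul_zero]

lemma torsionHom_eq_generatorHom (c : (A → Z2) × (B → Z2)) :
    torsionHom w z hz c = generatorHom w z hz (fun i => 2 * ((c.1 i).val : Z4), c.2) := by
  have key : ∀ x : Z2, (2 * (x.val : Z4)).val = 2 * x.val := by decide
  simp only [torsionHom_apply, generatorHom_apply, key, mul_nsmul]

lemma mem_closure_and_torsion_iff (hinj : Function.Injective (torsionHom w z hz))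
    (x : Amb α β) :
    x ∈ AddSubgroup.closure (Set.range w ∪ Set.range z) ∧ x + x = 0 ↔
      x ∈ (torsionHom w z hz).range := by
  rw [← range_generatorHom hz]
  constructor
  · rintro ⟨⟨c, rfl⟩, h⟩
    rw [← two_nsmul, two_nsmul_generatorHom, ← map_zero (torsionHom w z hz)] at h
    have h0 := congrArg Prod.fst (hinj h)
    have key : ∀ a : Z4, ZMod.castHom (show 2 ∣ 4 by decide) Z2 a = 0 →
        ∃ b : Z2, 2 * (b.val : Z4) = a := by decide
    choose b hb using fun i => key (c.1 i) (congrFun h0 i)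
    refine ⟨(b, c.2), ?_⟩
    rw [torsionHom_eq_generatorHom]
    congr 1
    exact Prod.ext (funext hb) rfl
  · rintro ⟨c, rfl⟩
    refine ⟨⟨_, (torsionHom_eq_generatorHom hz c).symm⟩, ?_⟩
    rw [← map_add]
    have : ∀ x : Z2, x + x = 0 := by decide
    have hc : c + c = 0 := Prod.ext (funext fun i => this _) (funext fun j => this _)
    rw [hc, map_zero]

lemma isOfType_closure (hinj : Function.Injective (torsionHom w z hz)) :
    isOfType (AddSubgroup.closure (Set.range w ∪ Set.range z))
      (Fintype.card B) (Fintype.card A) := by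
  classical
  have hginj : Function.Injective (generatorHom w z hz) := by
    rw [injective_iff_map_eq_zero]
    intro c hc
    have h2 : generatorHom w z hz c + generatorHom w z hz c = 0 := by rw [hc, add_zero]
    rw [← two_nsmul, two_nsmul_generatorHom, ← map_zero (torsionHom w z hz)] at h2
    have h0 := congrArg Prod.fst (hinj h2)
    have key : ∀ a : Z4, ZMod.castHom (show 2 ∣ 4 by decide) Z2 a = 0 →
        ∃ b : Z2, 2 * (b.val : Z4) = a := by decide
    choose b hb using fun i => key (c.1 i) (congrFun h0 i)
    have hcb : c = (fun i => 2 * ((b i).val : Z4), c.2) := Prod.ext (funext fun i => (hb i).symm) rfl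
    rw [hcb, ← torsionHom_eq_generatorHom hz (b, c.2), ← map_zero (torsionHom w z hz)] at hc
    have h3 := hinj hc
    rw [hcb]
    simp only [Prod.ext_iff] at h3
    obtain ⟨hb0, hc0⟩ := h3
    rw [hb0, hc0]
    ext i <;> simp
  constructor
  · rw [← range_generatorHom hz, ← Nat.card_congr (AddMonoidHom.ofInjective hginj).toEquiv,
      Nat.card_eq_fintype_card]
    simp only [Fintype.card_prod, Fintype.card_pi, ZMod.card, Finset.prod_const,
      Finset.card_univ]
    rw [show (4 : ℕ) = 2 ^ 2 by norm_num, ← pow_mul, ← pow_add, add_comm]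
  · simp_rw [mem_closure_and_torsion_iff hz hinj]
    refine (Nat.card_congr (AddMonoidHom.ofInjective hinj).toEquiv).symm.trans ?_
    simp only [Nat.card_eq_fintype_card, Fintype.card_prod, Fintype.card_pi, ZMod.card,
      Finset.prod_const, Finset.card_univ]
    rw [← pow_add, add_comm]

end Generators

/-- The Lee weight on `Z₄`. -/
def leeWeight (x : Z4) : ℕ := if x = 0 then 0 else if x = 2 then 2 else 1

lemma grayPhi_dist (x y : Z4) :
    ((if (grayPhi x).1 ≠ (grayPhi y).1 then 1 else 0) +
      if (grayPhi x).2 ≠ (grayPhi y).2 then 1 else 0) = leeWeight (x - y) := by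
  revert x y; decide

lemma hammingDist_grayMap {α β : ℕ} (u v : Amb α β) :
    hammingDist (grayMap u) (grayMap v) =
      ∑ i, leeWeight ((u - v).1 i).val + ∑ j, leeWeight ((u - v).2 j) := by
  have key : ∀ x y : Z2, (if x ≠ y then 1 else 0) = leeWeight ((x - y).val : Z4) := by decide
  rw [hammingDist, Finset.card_filter, Fintype.sum_sum_type, Fintype.sum_prod_type]
  simp only [Fin.sum_univ_two, Prod.fst_sub, Prod.snd_sub, Pi.sub_apply, ← key, ← grayPhi_dist]
  rfl

lemma grayMap_injective {α β : ℕ} : Function.Injective (grayMap (α := α) (β := β)) := by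
  intro u v h
  have h0 := hammingDist_grayMap u v
  rw [h, hammingDist_self, eq_comm, Nat.add_eq_zero_iff, Finset.sum_eq_zero_iff,
    Finset.sum_eq_zero_iff] at h0
  have key2 : ∀ x : Z2, leeWeight (x.val : Z4) = 0 → x = 0 := by decide
  have key4 : ∀ x : Z4, leeWeight x = 0 → x = 0 := by decide
  rw [← sub_eq_zero]
  exact Prod.ext (funext fun i => key2 _ (h0.1 i (Finset.mem_univ i)))
    (funext fun j => key4 _ (h0.2 j (Finset.mem_univ j)))

/-- The all-two vector `(1,…,1 | 2,…,2)`. -/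
def allTwo (α β : ℕ) : Amb α β := (fun _ => 1, fun _ => 2)

/-- The vector whose entries are the `i`-th coordinates of the columns `y` and `r`. -/
def coordWord {α β m : ℕ} (y : Fin α → Fin m → Z2) (r : Fin β → Fin m → Z4) (i : Fin m) :
    Amb α β :=
  (fun a => y a i, fun j => r j i)

/-- The additive code generated by the all-two vector and by the rows of the matrix with
binary columns `y` and quaternary columns `r`. -/
def hadamardCode {α β m : ℕ} (y : Fin α → Fin m → Z2) (r : Fin β → Fin m → Z4) :
    AddSubgroup (Amb α β) :=
  AddSubgroup.closure (Set.range (coordWord y r) ∪ Set.range fun _ : Unit => allTwo α β)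

/-- Each element of `Z₂^m` occurs exactly once in `y`, and each element of order four of
`Z₄^m` occurs exactly once up to sign in `r`. -/
structure IsColumnSystem {α β m : ℕ} (y : Fin α → Fin m → Z2) (r : Fin β → Fin m → Z4) :
    Prop where
  bijective : Function.Bijective y
  order_four : ∀ j, r j + r j ≠ 0
  eq_of_eq_or_neg : ∀ j j', r j = r j' ∨ r j = -r j' → j = j'
  exists_eq_or_neg : ∀ x, x + x ≠ 0 → ∃ j, r j = x ∨ r j = -x

lemma two_nsmul_allTwo (α β : ℕ) : 2 • allTwo α β = 0 := by
  refine Prod.ext (funext fun i => ?_) (funext fun j => ?_)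
  · exact (by decide : 2 • (1 : Z2) = 0)
  · exact (by decide : 2 • (2 : Z4) = 0)

lemma torsionHom_fst {α β : ℕ} {A B : Type*} [Fintype A] [Fintype B] {w : A → Amb α β}
    {z : B → Amb α β} (hz : ∀ b, 2 • z b = 0) (c : (A → Z2) × (B → Z2)) (a : Fin α) :
    (torsionHom w z hz c).1 a = ∑ j, c.2 j * (z j).1 a := by
  have h2 : ∀ x : Z2, 2 • x = 0 := by decide
  rw [torsionHom_apply]
  simp only [Prod.fst_add, Prod.fst_sum, Pi.add_apply, Finset.sum_apply, Prod.smul_fst,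
    Pi.smul_apply, h2, smul_zero, Finset.sum_const_zero, zero_add]
  exact Finset.sum_congr rfl fun j _ => by rw [nsmul_eq_mul, ZMod.natCast_zmod_val]

lemma torsionHom_snd {α β : ℕ} {A B : Type*} [Fintype A] [Fintype B] {w : A → Amb α β}
    {z : B → Amb α β} (hz : ∀ b, 2 • z b = 0) (c : (A → Z2) × (B → Z2)) (a : Fin β) :
    (torsionHom w z hz c).2 a =
      ∑ i, ((c.1 i).val : Z4) * (2 * (w i).2 a) + ∑ j, ((c.2 j).val : Z4) * (z j).2 a := by
  rw [torsionHom_apply]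
  simp only [Prod.snd_add, Prod.snd_sum, Pi.add_apply, Finset.sum_apply, Prod.smul_snd,
    Pi.smul_apply]
  simp only [nsmul_eq_mul, Nat.cast_ofNat]

lemma single_add_single_ne_zero {m : ℕ} (i : Fin m) :
    (Pi.single i 1 : Fin m → Z4) + Pi.single i 1 ≠ 0 := by
  intro h
  have := congrFun h i
  simp only [Pi.add_apply, Pi.single_eq_same, Pi.zero_apply] at this
  exact absurd this (by decide)

lemma IsColumnSystem.isOfType_hadamardCode {α β m : ℕ} {y : Fin α → Fin m → Z2}
    {r : Fin β → Fin m → Z4} (h : IsColumnSystem y r) :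
    isOfType (hadamardCode y r) 1 m := by
  have := isOfType_closure (w := coordWord y r) (z := fun _ : Unit => allTwo α β)
    (fun _ => two_nsmul_allTwo α β) ?_
  · rw [Fintype.card_unit, Fintype.card_fin] at this
    exact this
  rw [injective_iff_map_eq_zero]
  intro c hc
  obtain ⟨a, -⟩ := h.bijective.2 0
  have hc2 : c.2 () = 0 := by
    have := torsionHom_fst (w := coordWord y r) (z := fun _ : Unit => allTwo α β)
      (fun _ => two_nsmul_allTwo α β) c a
    rw [hc] at this
    simpa [allTwo] using this.symm
  refine Prod.ext (funext fun i => ?_) (funext fun _ => hc2)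
  obtain ⟨j, hj⟩ := h.exists_eq_or_neg (Pi.single i 1) (single_add_single_ne_zero i)
  have := torsionHom_snd (w := coordWord y r) (z := fun _ : Unit => allTwo α β)
      (fun _ => two_nsmul_allTwo α β) c j
  rw [hc] at this
  have key : ∀ x : Z2, (0 : Z4) = (x.val : Z4) * (2 * 1) ∨ (0 : Z4) = (x.val : Z4) * (2 * (-1)) →
    x = 0 := by decide
  apply key
  rcases hj with hj | hj
  · left
    simpa [coordWord, hj, hc2, Pi.single_apply] using this
  · right
    simpa [coordWord, hj, hc2, Pi.single_apply] using this

section Perfect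

variable {α β m : ℕ} {y : Fin α → Fin m → Z2} {r : Fin β → Fin m → Z4}

/-- The lift `Z₂^m → Z₄^m` with image the elements of order at most two. -/
def twoLift {m : ℕ} (v : Fin m → Z2) : Fin m → Z4 := fun i => 2 * ((v i).val : Z4)

/-- All columns, as elements of `Z₄^m`. -/
def column (y : Fin α → Fin m → Z2) (r : Fin β → Fin m → Z4) : Fin α ⊕ Fin β → Fin m → Z4 :=
  Sum.elim (fun a => twoLift (y a)) r

/-- The entries of a vector, with the binary ones lifted to `Z₄`. -/
def entry (v : Amb α β) : Fin α ⊕ Fin β → Z4 := Sum.elim (fun a => ((v.1 a).val : Z4)) v.2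

lemma addInner_coordWord (v : Amb α β) (i : Fin m) :
    addInner v (coordWord y r i) = (∑ p, entry v p • column y r p) i := by
  simp only [addInner, coordWord, Finset.sum_apply, Fintype.sum_sum_type, entry, column,
    Sum.elim_inl, Sum.elim_inr, Pi.smul_apply, smul_eq_mul, twoLift,
    Finset.mul_sum]
  congr 1
  exact Finset.sum_congr rfl fun _ _ => by ring

lemma addInner_allTwo (v : Amb α β) :
    addInner v (allTwo α β) = 2 * ∑ p, entry v p := by
  simp only [addInner, allTwo, Fintype.sum_sum_type, entry, Sum.elim_inl, Sum.elim_inr,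
    Finset.mul_sum, mul_add]
  congr 1
  · exact Finset.sum_congr rfl fun _ _ => by rw [ZMod.val_one]; simp
  · exact Finset.sum_congr rfl fun _ _ => mul_comm _ _

lemma mem_dualCode_hadamardCode (v : Amb α β) :
    v ∈ dualCode (hadamardCode y r) ↔
      ∑ p, entry v p • column y r p = 0 ∧ 2 * ∑ p, entry v p = 0 := by
  rw [hadamardCode, mem_dualCode_closure]
  simp only [Set.mem_union, Set.mem_range, exists_const, ← addInner_allTwo]
  constructor
  · intro h
    refine ⟨funext fun i => ?_, h _ (Or.inr rfl)⟩
    rw [← addInner_coordWord]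
    exact h _ (Or.inl ⟨i, rfl⟩)
  · rintro ⟨h1, h2⟩ _ (⟨i, rfl⟩ | rfl)
    · rw [addInner_coordWord, h1]; rfl
    · exact h2

lemma hammingDist_grayMap_eq_sum (u v : Amb α β) :
    hammingDist (grayMap u) (grayMap v) = ∑ p, leeWeight (entry (u - v) p) := by
  rw [hammingDist_grayMap, Fintype.sum_sum_type]
  rfl

lemma twoLift_add_self (v : Fin m → Z2) : twoLift v + twoLift v = 0 := by
  have : ∀ x : Z2, 2 * (x.val : Z4) + 2 * (x.val : Z4) = 0 := by decide
  exact funext fun i => this (v i)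

lemma twoLift_injective : Function.Injective (twoLift (m := m)) := by
  have : ∀ x y : Z2, 2 * (x.val : Z4) = 2 * (y.val : Z4) → x = y := by decide
  exact fun u v h => funext fun i => this _ _ (congrFun h i)

lemma IsColumnSystem.column_eq_or_neg (h : IsColumnSystem y r) {p q : Fin α ⊕ Fin β}
    (hpq : column y r p = column y r q ∨ column y r p = -column y r q) : p = q := by
  have hneg : ∀ v : Fin m → Z2, -twoLift v = twoLift v := fun v =>
    neg_eq_of_add_eq_zero_left (twoLift_add_self v)
  have hmix : ∀ a j, r j ≠ twoLift (y a) := fun a j hj =>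
    h.order_four j (by rw [hj, twoLift_add_self])
  rcases p with a | j <;> rcases q with b | k
  · simp only [column, Sum.elim_inl, hneg, or_self] at hpq
    rw [h.bijective.1 (twoLift_injective hpq)]
  · simp only [column, Sum.elim_inl, Sum.elim_inr] at hpq
    rcases hpq with hpq | hpq
    · exact (hmix a k hpq.symm).elim
    · exact (hmix a k (by rw [← hneg, hpq, neg_neg])).elim
  · simp only [column, Sum.elim_inl, Sum.elim_inr, hneg, or_self] at hpq
    exact (hmix b j hpq).elim
  · rw [h.eq_of_eq_or_neg j k hpq]

lemma IsColumnSystem.four_le_sum_leeWeight (h : IsColumnSystem y r) {v : Amb α β}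
    (hv : v ∈ dualCode (hadamardCode y r)) (hv0 : v ≠ 0) :
    4 ≤ ∑ p, leeWeight (entry v p) := by
  classical
  rw [mem_dualCode_hadamardCode] at hv
  obtain ⟨hsyn, hpar⟩ := hv
  have hzero : ∀ x : Z4, leeWeight x = 0 → x = 0 := by decide
  have heven : 2 ∣ ∑ p, leeWeight (entry v p) := by
    have hlee : ∀ x : Z4, 2 * (leeWeight x : Z4) = 2 * x := by decide
    have : ((2 * ∑ p, leeWeight (entry v p) : ℕ) : Z4) = 0 := by
      rw [← hpar]
      push_cast
      simp only [Finset.mul_sum, hlee]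
    rw [ZMod.natCast_eq_zero_iff] at this
    omega
  obtain ⟨p, hp⟩ : ∃ p, leeWeight (entry v p) ≠ 0 := by
    by_contra! hall
    have key2 : ∀ x : Z2, leeWeight (x.val : Z4) = 0 → x = 0 := by decide
    exact hv0 (Prod.ext (funext fun a => key2 _ (hall (Sum.inl a)))
      (funext fun j => hzero _ (hall (Sum.inr j))))
  by_contra! hlt
  have hsplit := Finset.add_sum_erase Finset.univ (fun p => leeWeight (entry v p))
    (Finset.mem_univ p)
  have h2 : ∀ x : Z4, leeWeight x = 2 → x = 2 := by decide
  have h1 : ∀ x : Z4, leeWeight x = 1 → x = 1 ∨ x = -1 := by decide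
  by_cases hp2 : leeWeight (entry v p) = 2
  · have hrest : ∑ q ∈ Finset.univ.erase p, leeWeight (entry v q) = 0 := by omega
    rw [Finset.sum_eq_zero_iff] at hrest
    rw [Finset.sum_eq_single p (fun q _ hq => by
      rw [hzero _ (hrest q (Finset.mem_erase.2 ⟨hq, Finset.mem_univ q⟩)), zero_smul])
      (by simp), h2 _ hp2] at hsyn
    rcases p with a | j
    · have key2 : ∀ x : Z2, leeWeight (x.val : Z4) ≠ 2 := by decide
      exact key2 _ hp2
    · exact h.order_four j (by rw [← hsyn, two_smul]; rfl)
  · have hle : ∀ x : Z4, leeWeight x ≤ 2 := by decide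
    have hlep := hle (entry v p)
    obtain ⟨q, hq, hq0⟩ := Finset.exists_ne_zero_of_sum_ne_zero
      (show ∑ q ∈ Finset.univ.erase p, leeWeight (entry v q) ≠ 0 by omega)
    have hsplit' := Finset.add_sum_erase _ (fun p => leeWeight (entry v p)) hq
    have hp1 : leeWeight (entry v p) = 1 := by omega
    have hq1 : leeWeight (entry v q) = 1 := by omega
    have hrest : ∑ q ∈ (Finset.univ.erase p).erase q, leeWeight (entry v q) = 0 := by omega
    rw [Finset.sum_eq_zero_iff] at hrest
    have hqp : q ≠ p := (Finset.mem_erase.1 hq).1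
    rw [← Finset.add_sum_erase _ _ (Finset.mem_univ p), ← Finset.add_sum_erase _ _ hq,
      Finset.sum_eq_zero (fun x hx => by rw [hzero _ (hrest x hx), zero_smul]),
      add_zero] at hsyn
    apply hqp
    apply h.column_eq_or_neg
    rcases h1 _ hp1 with e | e <;> rcases h1 _ hq1 with e' | e' <;>
      rw [e, e'] at hsyn <;> simp only [one_smul, neg_smul] at hsyn
    · exact Or.inr (eq_neg_of_add_eq_zero_right hsyn)
    · exact Or.inl (by rw [← sub_eq_add_neg] at hsyn; exact (sub_eq_zero.1 hsyn).symm)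
    · exact Or.inl ((neg_add_eq_zero.1 hsyn).symm)
    · exact Or.inr (eq_neg_of_add_eq_zero_right (by rw [← neg_eq_zero]; rw [← hsyn]; abel))

lemma IsColumnSystem.exists_sum_leeWeight_eq_four (h : IsColumnSystem y r) (hm : 2 ≤ m) :
    ∃ v ∈ dualCode (hadamardCode y r), v ≠ 0 ∧ ∑ p, leeWeight (entry v p) = 4 := by
  classical
  let i₀ : Fin m := ⟨0, by omega⟩
  let i₁ : Fin m := ⟨1, by omega⟩
  have hi : i₀ ≠ i₁ := by simp [i₀, i₁]
  let P : Finset (Fin m → Z2) := {0, Pi.single i₀ 1, Pi.single i₁ 1, Pi.single i₀ 1 + Pi.single i₁ 1}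
  have hPsum : ∀ {M : Type} [AddCommMonoid M] (f : (Fin m → Z2) → M), ∑ x ∈ P, f x =
      f 0 + (f (Pi.single i₀ 1) + (f (Pi.single i₁ 1) + f (Pi.single i₀ 1 + Pi.single i₁ 1))) := by
    intro M _ f
    have e01 : (Pi.single i₀ 1 : Fin m → Z2) i₁ = 0 := Pi.single_eq_of_ne hi.symm _
    have e10 : (Pi.single i₁ 1 : Fin m → Z2) i₀ = 0 := Pi.single_eq_of_ne hi _
    rw [Finset.sum_insert, Finset.sum_insert, Finset.sum_insert, Finset.sum_singleton]
    all_goals simp only [Finset.mem_insert, Finset.mem_singleton, funext_iff, not_or, not_forall]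
    · exact ⟨i₀, by simp [e10]⟩
    · exact ⟨⟨i₀, by simp [e10]⟩, ⟨i₁, by simp [e01]⟩⟩
    · exact ⟨⟨i₀, by simp⟩, ⟨i₁, by simp⟩, ⟨i₀, by simp [e10]⟩⟩
  let v : Amb α β := (fun a => if y a ∈ P then 1 else 0, 0)
  have hsum : ∀ {M : Type} [AddCommMonoid M] (f : (Fin m → Z2) → M),
      ∑ a, (if y a ∈ P then f (y a) else 0) = ∑ x ∈ P, f x := by
    intro M _ f
    rw [h.bijective.sum_comp (fun x => if x ∈ P then f x else 0)]
    simp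
  have hinl : ∀ a, entry v (Sum.inl a) = if y a ∈ P then 1 else 0 := by
    intro a
    simp only [entry, v, Sum.elim_inl]
    split_ifs <;> simp [ZMod.val_one]
  have hinr : ∀ j, entry v (Sum.inr j) = 0 := fun j => rfl
  have hlee : ∑ p, leeWeight (entry v p) = 4 := by
    rw [Fintype.sum_sum_type]
    simp only [hinl, hinr]
    have h01 : ∀ a, leeWeight (if y a ∈ P then 1 else 0) = if y a ∈ P then 1 else 0 := by
      intro a
      split_ifs <;> rfl
    simp only [h01]
    rw [hsum (fun _ => (1 : ℕ)), hPsum]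
    simp [leeWeight]
  refine ⟨v, ?_, ?_, hlee⟩
  · rw [mem_dualCode_hadamardCode, Fintype.sum_sum_type, Fintype.sum_sum_type]
    simp only [hinl, hinr, zero_smul, Finset.sum_const_zero, add_zero, ite_smul, one_smul,
      column, Sum.elim_inl]
    rw [hsum twoLift, hsum (fun _ => (1 : Z4)), hPsum, hPsum]
    refine ⟨?_, by decide⟩
    have key : ∀ s t : Z2, 2 * ((0 : Z2).val : Z4) + (2 * (s.val : Z4) + (2 * (t.val : Z4) +
      2 * ((s + t).val : Z4))) = 0 := by decide
    exact funext fun i => key _ _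
  · intro h0
    rw [h0] at hlee
    have hz : ∀ p, entry (0 : Amb α β) p = 0 := by
      rintro (a | j)
      · simp [entry]
      · rfl
    simp [hz, leeWeight] at hlee

lemma IsColumnSystem.isAddExtPerfect_dualCode (h : IsColumnSystem y r) (hm : 2 ≤ m)
    (hα : 1 ≤ α) (hlen : α + 2 * β = 2 ^ (2 * m)) :
    isAddExtPerfect (2 * m) α β (dualCode (hadamardCode y r)) := by
  refine ⟨hα, hlen, ?_, ?_, ?_⟩
  · rw [Nat.card_image_of_injective grayMap_injective]
    have hcard := card_mul_card_dualCode (hadamardCode y r)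
    rw [h.isOfType_hadamardCode.1] at hcard
    have hamb : Nat.card (Amb α β) = 2 ^ (2 ^ (2 * m)) := by
      rw [Nat.card_eq_fintype_card]
      simp only [Fintype.card_prod, Fintype.card_pi, ZMod.card, Finset.prod_const,
        Finset.card_univ, Fintype.card_fin]
      rw [show (4 : ℕ) = 2 ^ 2 by norm_num, ← pow_mul, ← pow_add, hlen]
    have hle : 2 * m + 1 ≤ 2 ^ (2 * m) := Nat.lt_two_pow_self
    rw [hamb, show 2 ^ (2 * m) = (1 + 2 * m) + (2 ^ (2 * m) - 2 * m - 1) by omega] at hcard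
    exact Nat.eq_of_mul_eq_mul_left (pow_pos two_pos (1 + 2 * m)) (hcard.trans (pow_add _ _ _))
  · rintro _ ⟨u, hu, rfl⟩ _ ⟨v, hv, rfl⟩ hne
    rw [hammingDist_grayMap_eq_sum]
    apply h.four_le_sum_leeWeight (sub_mem hu hv)
    rw [sub_ne_zero]
    rintro rfl
    exact hne rfl
  · obtain ⟨v, hv, hv0, hsum⟩ := h.exists_sum_leeWeight_eq_four hm
    refine ⟨_, ⟨v, hv, rfl⟩, _, ⟨0, zero_mem _, rfl⟩, grayMap_injective.ne hv0, ?_⟩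
    rw [hammingDist_grayMap_eq_sum, sub_zero, hsum]

end Perfect

lemma add_self_eq_zero_iff_mem_range_twoLift {m : ℕ} (x : Fin m → Z4) :
    x + x = 0 ↔ x ∈ Set.range (twoLift (m := m)) := by
  constructor
  · intro h
    have key : ∀ a : Z4, a + a = 0 → ∃ b : Z2, 2 * (b.val : Z4) = a := by decide
    choose b hb using fun i => key (x i) (congrFun h i)
    exact ⟨b, funext hb⟩
  · rintro ⟨v, rfl⟩
    exact twoLift_add_self v

lemma exists_isColumnSystem {m : ℕ} (hm : 1 ≤ m) :
    ∃ (y : Fin (2 ^ m) → Fin m → Z2)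
      (r : Fin (2 ^ (2 * m - 1) - 2 ^ (m - 1)) → Fin m → Z4), IsColumnSystem y r := by
  classical
  let f := Fintype.equivFin (Fin m → Z4)
  let R : Finset (Fin m → Z4) := Finset.univ.filter fun x => f x < f (-x)
  have hself : ∀ x : Fin m → Z4, x + x = 0 ↔ f x = f (-x) := fun x => by
    rw [f.injective.eq_iff, eq_neg_iff_add_eq_zero]
  have hneg : (Finset.univ.filter fun x => f (-x) < f x).card = R.card :=
    Finset.card_equiv (Equiv.neg _) (by simp [R])
  have htwo : (Finset.univ.filter fun x : Fin m → Z4 => x + x = 0).card = 2 ^ m := by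
    have : (Finset.univ.filter fun x : Fin m → Z4 => x + x = 0) =
        Finset.univ.image twoLift := by
      ext x
      simp [add_self_eq_zero_iff_mem_range_twoLift]
    rw [this, Finset.card_image_of_injective _ twoLift_injective]
    simp
  have hcard : R.card = 2 ^ (2 * m - 1) - 2 ^ (m - 1) := by
    have hsum : R.card + R.card + 2 ^ m = 4 ^ m := by
      have huniv : (Finset.univ : Finset (Fin m → Z4)) =
          (R ∪ Finset.univ.filter fun x => f (-x) < f x) ∪
            Finset.univ.filter fun x => x + x = 0 := by
        ext x
        simp only [R, Finset.mem_union, Finset.mem_filter, Finset.mem_univ, true_and, true_iff,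
          hself]
        rcases lt_trichotomy (f x) (f (-x)) with h | h | h <;> simp [h]
      have hc := congrArg Finset.card huniv
      rw [Finset.card_union_of_disjoint, Finset.card_union_of_disjoint, hneg, htwo] at hc
      · rw [← hc]; simp
      · rw [Finset.disjoint_left]
        intro x hx hx'
        simp only [R, Finset.mem_filter] at hx hx'
        exact lt_asymm hx.2 hx'.2
      · rw [Finset.disjoint_left]
        intro x hx hx'
        simp only [R, Finset.mem_union, Finset.mem_filter, Finset.mem_univ, true_and,
          hself] at hx hx'
        rcases hx with hx | hx
        · exact hx.ne hx'
        · exact hx.ne' hx'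
    obtain ⟨n, rfl⟩ : ∃ n, m = n + 1 := ⟨m - 1, by omega⟩
    have e1 : 2 * (n + 1) - 1 = 2 * n + 1 := by omega
    have e2 : (4 : ℕ) ^ (n + 1) = 2 * 2 ^ (2 * n + 1) := by
      rw [show (4 : ℕ) = 2 ^ 2 by norm_num, ← pow_mul]; ring
    have e3 : 2 ^ (n + 1) = 2 * 2 ^ n := by ring
    rw [e1, Nat.add_sub_cancel]
    omega
  have hy : Fintype.card (Fin m → Z2) = 2 ^ m := by simp
  let er := R.equivFinOfCardEq hcard
  have hmem : ∀ j, f (er.symm j : Fin m → Z4) < f (-(er.symm j : Fin m → Z4)) := fun j =>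
    (Finset.mem_filter.1 (er.symm j).2).2
  refine ⟨(Fintype.equivFinOfCardEq hy).symm, fun j => er.symm j, Equiv.bijective _, ?_, ?_, ?_⟩
  · intro j hj
    exact (hmem j).ne ((hself _).1 hj)
  · rintro j j' (h | h)
    · exact er.symm.injective (Subtype.ext h)
    · have h1 := hmem j
      have h2 := hmem j'
      rw [h, neg_neg] at h1
      exact (lt_asymm h1 h2).elim
  · intro x hx
    rcases lt_trichotomy (f x) (f (-x)) with h | h | h
    · exact ⟨er ⟨x, by simpa [R] using h⟩, Or.inl (by simp)⟩
    · exact (hx ((hself x).2 h)).elim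
    · exact ⟨er ⟨-x, by simpa [R] using h⟩, Or.inr (by simp)⟩

/-- The two nonzero entries of a special point; see `specialPoint`. -/
def specialEntries (k : Fin 3) (s b : Bool) : Z4 × Z4 :=
  (if s then -1 else 1) *
    (if k = 0 then (2, 1) else if k = 1 then (if b then 1 else -1, 1) else (1, 0))

section SpecialPoints

variable {m : ℕ} (t : Fin m → Fin m)

/-- Up to sign, the points `e_{t i} + 2 e_i`, `e_{t i} ± e_i` and `e_i` of `Z₄^m`. -/
def specialPoint (c : Fin m × Fin 3 × Bool) : Fin m → Z4 :=
  Pi.single c.1 (specialEntries c.2.1 c.2.2 (c.1 < t c.1)).1 +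
    Pi.single (t c.1) (specialEntries c.2.1 c.2.2 (c.1 < t c.1)).2

variable {t}

lemma specialPoint_injective (ht : ∀ i, t i ≠ i) : Function.Injective (specialPoint t) := by
  rintro ⟨i, k, s⟩ ⟨j, k', s'⟩ h
  have hsame : ∀ k s k' s' b, specialEntries k s b = specialEntries k' s' b →
      k = k' ∧ s = s' := by decide
  have hne : ∀ k s b, (specialEntries k s b).1 ≠ 0 := by decide
  have hdiff : ∀ k s k' s' b, (specialEntries k s b).1 = (specialEntries k' s' !b).2 →
      (specialEntries k' s' !b).1 = (specialEntries k s b).2 → False := by decide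
  simp only [specialPoint] at h
  by_cases hij : i = j
  · subst hij
    have h1 := congrFun h i
    have h2 := congrFun h (t i)
    simp [ht i, (ht i).symm] at h1 h2
    obtain ⟨rfl, rfl⟩ := hsame _ _ _ _ _ (Prod.ext h1 h2)
    rfl
  · exfalso
    have h1 := congrFun h i
    have h2 := congrFun h j
    have hi : i = t j := by
      by_contra hi
      simp [hij, hi, (ht i).symm, hne] at h1
    have hj : j = t i := by
      by_contra hj
      simp [Ne.symm hij, hj, (ht j).symm] at h2
      exact hne _ _ _ h2.symm
    simp only [Pi.add_apply, Pi.single_apply, hij, ← hi, ← hj, if_true, if_false, Ne.symm hij,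
      add_zero, zero_add] at h1 h2
    have hlt : decide (j < i) = !decide (i < j) := by
      rcases lt_or_gt_of_ne hij with h | h <;> simp [h, h.le]
    rw [hlt] at h1 h2
    exact hdiff _ _ _ _ _ h1 h2.symm

lemma neg_specialPoint (i : Fin m) (k : Fin 3) (s : Bool) :
    -specialPoint t (i, k, s) = specialPoint t (i, k, !s) := by
  have key : ∀ k s b, specialEntries k (!s) b = -specialEntries k s b := by decide
  simp only [specialPoint, key, Prod.fst_neg, Prod.snd_neg, Pi.single_neg, neg_add]

lemma specialPoint_add_self_ne_zero (ht : ∀ i, t i ≠ i) (c : Fin m × Fin 3 × Bool) :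
    specialPoint t c + specialPoint t c ≠ 0 := by
  intro h
  obtain ⟨i, k, s⟩ := c
  have h' := eq_neg_of_add_eq_zero_left h
  rw [neg_specialPoint] at h'
  have := specialPoint_injective ht h'
  simp at this

lemma sum_mul_specialPoint (f : Fin m → Z4) (c : Fin m × Fin 3 × Bool) :
    ∑ l, f l * specialPoint t c l =
      f c.1 * (specialEntries c.2.1 c.2.2 (c.1 < t c.1)).1 +
        f (t c.1) * (specialEntries c.2.1 c.2.2 (c.1 < t c.1)).2 := by
  simp [specialPoint, mul_add, Finset.sum_add_distrib, Pi.single_apply]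

variable (t) (K F : Finset (Fin m))

/-- The involution of the labels of the special points swapping `e_{t i} + 2 e_i` and
`e_{t i} ± e_i` for `i ∈ K` and changing the sign of `e_i` for `i ∈ F`. -/
def labelMove (c : Fin m × Fin 3 × Bool) : Fin m × Fin 3 × Bool :=
  if c.1 ∈ K then (if c.2.1 = 2 then c else (c.1, 1 - c.2.1, c.2.2))
  else if c.1 ∈ F then (if c.2.1 = 2 then (c.1, c.2.1, !c.2.2) else c) else c

/-- The permutation of `Z₄^m` induced by `labelMove`. -/
noncomputable def pointMove : (Fin m → Z4) → Fin m → Z4 :=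
  Function.extend (specialPoint t) (specialPoint t ∘ labelMove K F) id

variable {t K F}

lemma labelMove_labelMove (c : Fin m × Fin 3 × Bool) :
    labelMove K F (labelMove K F c) = c := by
  obtain ⟨i, k, s⟩ := c
  by_cases hK : i ∈ K <;> by_cases hF : i ∈ F <;> fin_cases k <;> simp [labelMove, hK, hF]

lemma labelMove_neg (i : Fin m) (k : Fin 3) (s : Bool) :
    labelMove K F (i, k, !s) =
      ((labelMove K F (i, k, s)).1, (labelMove K F (i, k, s)).2.1,
        !(labelMove K F (i, k, s)).2.2) := by
  by_cases hK : i ∈ K <;> by_cases hF : i ∈ F <;> fin_cases k <;> simp [labelMove, hK, hF]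

lemma pointMove_specialPoint (ht : ∀ i, t i ≠ i) (c : Fin m × Fin 3 × Bool) :
    pointMove t K F (specialPoint t c) = specialPoint t (labelMove K F c) :=
  (specialPoint_injective ht).extend_apply _ _ _

lemma pointMove_of_notMem {x : Fin m → Z4} (hx : ¬∃ c, specialPoint t c = x) :
    pointMove t K F x = x :=
  Function.extend_apply' _ _ _ hx

lemma pointMove_pointMove (ht : ∀ i, t i ≠ i) (x : Fin m → Z4) :
    pointMove t K F (pointMove t K F x) = x := by
  by_cases hx : ∃ c, specialPoint t c = x
  · obtain ⟨c, rfl⟩ := hx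
    simp only [pointMove_specialPoint ht, labelMove_labelMove]
  · simp only [pointMove_of_notMem hx]

lemma pointMove_neg (ht : ∀ i, t i ≠ i) (x : Fin m → Z4) :
    pointMove t K F (-x) = -pointMove t K F x := by
  by_cases hx : ∃ c, specialPoint t c = x
  · obtain ⟨⟨i, k, s⟩, rfl⟩ := hx
    rw [neg_specialPoint, pointMove_specialPoint ht, pointMove_specialPoint ht, labelMove_neg,
      ← neg_specialPoint]
  · rw [pointMove_of_notMem hx, pointMove_of_notMem]
    rintro ⟨⟨i, k, s⟩, hc⟩
    exact hx ⟨(i, k, !s), by rw [← neg_specialPoint, hc, neg_neg]⟩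

lemma pointMove_add_self_ne_zero (ht : ∀ i, t i ≠ i) {x : Fin m → Z4} (hx : x + x ≠ 0) :
    pointMove t K F x + pointMove t K F x ≠ 0 := by
  by_cases h : ∃ c, specialPoint t c = x
  · obtain ⟨c, rfl⟩ := h
    rw [pointMove_specialPoint ht]
    exact specialPoint_add_self_ne_zero ht _
  · rwa [pointMove_of_notMem h]

lemma pointMove_apply_of_notMem (ht : ∀ i, t i ≠ i) {l : Fin m} (hK : l ∉ K) (hF : l ∉ F)
    (x : Fin m → Z4) : pointMove t K F x l = x l := by
  have key : ∀ k s b, k ≠ 2 →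
    (specialEntries (1 - k) s b).2 = (specialEntries k s b).2 := by decide
  have key3 : ∀ s b, (specialEntries 2 s b).2 = 0 := by decide
  by_cases h : ∃ c, specialPoint t c = x
  · obtain ⟨⟨i, k, s⟩, rfl⟩ := h
    rw [pointMove_specialPoint ht]
    by_cases hli : l = i
    · subst hli
      simp [labelMove, hK, hF]
    · by_cases hiK : i ∈ K
      · by_cases hk : k = 2
        · simp [labelMove, hiK, hk]
        · simp [labelMove, hiK, hk, specialPoint, hli, key]
      · by_cases hiF : i ∈ F
        · by_cases hk : k = 2
          · simp [labelMove, hiK, hiF, hk, specialPoint, hli, key3]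
          · simp [labelMove, hiK, hiF, hk]
        · simp [labelMove, hiK, hiF]
  · rw [pointMove_of_notMem h]

lemma two_mul_pointMove_sub (ht : ∀ i, t i ≠ i) {l : Fin m} (hK : l ∉ K)
    (x : Fin m → Z4) : 2 * (pointMove t K F x l - x l) = 0 := by
  by_cases hF : l ∈ F
  swap
  · rw [pointMove_apply_of_notMem ht hK hF, sub_self, mul_zero]
  have key : ∀ k s b, k ≠ 2 →
    (specialEntries (1 - k) s b).2 = (specialEntries k s b).2 := by decide
  have key2 : ∀ s b, 2 * ((specialEntries 2 (!s) b).1 - (specialEntries 2 s b).1) = 0 := by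
    decide
  have key3 : ∀ s b, (specialEntries 2 s b).2 = 0 := by decide
  by_cases h : ∃ c, specialPoint t c = x
  · obtain ⟨⟨i, k, s⟩, rfl⟩ := h
    rw [pointMove_specialPoint ht]
    by_cases hli : l = i
    · subst hli
      by_cases hk : k = 2
      · simp [labelMove, hK, hF, hk, specialPoint, (ht l).symm, key2]
      · simp [labelMove, hK, hF, hk]
    · by_cases hiK : i ∈ K
      · by_cases hk : k = 2
        · simp [labelMove, hiK, hk]
        · simp [labelMove, hiK, hk, specialPoint, hli, key]
      · by_cases hiF : i ∈ F
        · by_cases hk : k = 2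
          · simp [labelMove, hiK, hiF, hk, specialPoint, hli, key3]
          · simp [labelMove, hiK, hiF, hk]
        · simp [labelMove, hiK, hiF]
  · rw [pointMove_of_notMem h, sub_self, mul_zero]

end SpecialPoints

section BinaryMove

variable {n : ℕ} {S : Finset (Fin (n + 2))}

/-- The linear form `v ↦ v₀ + v_{n+1}` for `i = 0`, and `v ↦ v_{i-1}` otherwise. -/
def shiftForm (v : Fin (n + 2) → Z2) : Fin (n + 2) → Z2 :=
  Fin.cons (v 0 + v (Fin.last (n + 1))) fun i => v i.castSucc

variable (S) in
/-- The linear map adding `shiftForm` to the coordinates in `S`. -/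
def binaryMove (v : Fin (n + 2) → Z2) : Fin (n + 2) → Z2 :=
  fun i => v i + if i ∈ S then shiftForm v i else 0

lemma binaryMove_injective (hS : 0 ∈ S → S = Finset.univ) :
    Function.Injective (binaryMove S) := by
  intro u v huv
  have key : ∀ a b c d : Z2, a + b = c + d → a - c = b - d := by decide
  have key' : ∀ a b c d e f : Z2, a + (b + c) = d + (e + f) → a - d = (b - e) + (c - f) := by
    decide
  have key0 : ∀ a b c d : Z2, a - b = (a - b) + (c - d) → c - d = 0 := by decide
  suffices h : ∀ i, u i - v i = 0 from funext fun i => sub_eq_zero.1 (h i)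
  have hi : ∀ i, u i + (if i ∈ S then shiftForm u i else 0) =
      v i + if i ∈ S then shiftForm v i else 0 := fun i => congrFun huv i
  by_cases h0 : 0 ∈ S
  · have hall : ∀ i, i ∈ S := by simp [hS h0]
    simp only [hall, if_true] at hi
    have hlast : u (Fin.last (n + 1)) - v (Fin.last (n + 1)) = 0 :=
      key0 _ _ _ _ (key' _ _ _ _ _ _ (hi 0))
    have hconst : ∀ i, u i - v i = u 0 - v 0 := by
      intro i
      induction i using Fin.induction with
      | zero => rfl
      | succ i ih =>
        rw [← ih]
        exact key _ _ _ _ (hi i.succ)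
    intro i
    rw [hconst i, ← hconst (Fin.last (n + 1)), hlast]
  · intro i
    induction i using Fin.induction with
    | zero =>
      have := hi 0
      simp only [h0, if_false, add_zero] at this
      rw [this, sub_self]
    | succ i ih =>
      by_cases hs : i.succ ∈ S
      · have := hi i.succ
        simp only [hs, if_true] at this
        rw [← ih]
        exact key _ _ _ _ this
      · have := hi i.succ
        simp only [hs, if_false, add_zero] at this
        rw [this, sub_self]

/-- `1` and the forms `shiftForm · i` are linearly independent. -/
lemma eq_zero_of_add_sum_shiftForm (b₀ : Z2) (b : S → Z2)
    (h : ∀ v : Fin (n + 2) → Z2, b₀ + ∑ i : S, b i * shiftForm v (i : Fin (n + 2)) = 0) :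
    b₀ = 0 ∧ ∀ i, b i = 0 := by
  have hcons : ∀ (v : Fin (n + 2) → Z2) (j : Fin (n + 1)), shiftForm v j.succ = v j.castSucc :=
    fun v j => rfl
  have hzero : ∀ v : Fin (n + 2) → Z2, shiftForm v 0 = v 0 + v (Fin.last (n + 1)) := fun v => rfl
  have hb₀ : b₀ = 0 := by
    have hs : ∀ i, shiftForm (0 : Fin (n + 2) → Z2) i = 0 := by
      intro i
      cases i using Fin.cases <;> simp [hcons, hzero]
    simpa [hs] using h 0
  have hfirst : ∀ h0 : 0 ∈ S, b ⟨0, h0⟩ = 0 := by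
    intro h0
    have := h (Pi.single (Fin.last (n + 1)) 1)
    rw [hb₀, zero_add, Finset.sum_eq_single ⟨0, h0⟩] at this
    · simpa [hzero, (Fin.last_pos' (n := n + 1)).ne] using this
    · rintro ⟨i, hi⟩ _ hne
      cases i using Fin.cases with
      | zero => exact (hne rfl).elim
      | succ j => simp [hcons, (Fin.castSucc_lt_last j).ne]
    · simp
  refine ⟨hb₀, ?_⟩
  rintro ⟨i, hi⟩
  cases i using Fin.cases with
  | zero => exact hfirst hi
  | succ j =>
    have := h (Pi.single j.castSucc 1)
    rw [hb₀, zero_add, Finset.sum_eq_single ⟨j.succ, hi⟩] at this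
    · simpa [hcons] using this
    · rintro ⟨i, hi'⟩ _ hne
      cases i using Fin.cases with
      | zero => rw [hfirst hi', zero_mul]
      | succ k =>
        have hkj : k ≠ j := fun e => hne (by subst e; rfl)
        simp [hcons, hkj]
    · simp

end BinaryMove

lemma IsColumnSystem.move {α β n : ℕ} {y : Fin α → Fin (n + 2) → Z2}
    {r : Fin β → Fin (n + 2) → Z4} (h : IsColumnSystem y r) {t : Fin (n + 2) → Fin (n + 2)}
    (ht : ∀ i, t i ≠ i) {K F S : Finset (Fin (n + 2))} (hS : 0 ∈ S → S = Finset.univ) :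
    IsColumnSystem (fun a => binaryMove S (y a)) fun j => pointMove t K F (r j) where
  bijective := (Finite.injective_iff_bijective.1 (binaryMove_injective hS)).comp h.bijective
  order_four j := pointMove_add_self_ne_zero ht (h.order_four j)
  eq_of_eq_or_neg j j' hj := by
    have hinj : Function.Injective (pointMove t K F) :=
      (show Function.Involutive (pointMove t K F) from pointMove_pointMove ht).injective
    rw [← pointMove_neg ht, hinj.eq_iff, hinj.eq_iff] at hj
    exact h.eq_of_eq_or_neg j j' hj
  exists_eq_or_neg x hx := by
    obtain ⟨j, hj⟩ := h.exists_eq_or_neg _ (pointMove_add_self_ne_zero (K := K) (F := F) ht hx)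
    refine ⟨j, hj.imp (fun e => ?_) fun e => ?_⟩
    · rw [e, pointMove_pointMove ht]
    · rw [e, pointMove_neg ht, pointMove_pointMove ht]

lemma card_fst_torsion {α β : ℕ} {A B B' : Type*} [Fintype A] [Fintype B] [Fintype B']
    {w : A → Amb α β} {z : B ⊕ B' → Amb α β} (hz : ∀ b, 2 • z b = 0)
    (hinj : Function.Injective (torsionHom w z hz)) (hfst : ∀ b, (z (Sum.inr b)).1 = 0)
    (hind : ∀ b : B → Z2, (∀ a, ∑ j, b j * (z (Sum.inl j)).1 a = 0) → b = 0) :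
    Nat.card ↥(Prod.fst '' {x : Amb α β |
      x ∈ AddSubgroup.closure (Set.range w ∪ Set.range z) ∧ x + x = 0}) =
        2 ^ Fintype.card B := by
  classical
  have hval : ∀ c a, (torsionHom w z hz c).1 a =
      ∑ j, c.2 (Sum.inl j) * (z (Sum.inl j)).1 a := by
    intro c a
    rw [torsionHom_fst, Fintype.sum_sum_type]
    simp [hfst]
  let G : (B → Z2) →+ (Fin α → Z2) := AddMonoidHom.mk' (fun b a => ∑ j, b j * (z (Sum.inl j)).1 a)
    (fun b b' => by
      ext a
      simp [add_mul, Finset.sum_add_distrib])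
  have hG : Function.Injective G := by
    rw [injective_iff_map_eq_zero]
    exact fun b hb => hind b fun a => congrFun hb a
  have himage : Prod.fst '' {x : Amb α β |
      x ∈ AddSubgroup.closure (Set.range w ∪ Set.range z) ∧ x + x = 0} = Set.range G := by
    simp_rw [mem_closure_and_torsion_iff hz hinj]
    ext g
    constructor
    · rintro ⟨_, ⟨c, rfl⟩, rfl⟩
      exact ⟨fun j => c.2 (Sum.inl j), funext fun a => (hval c a).symm⟩
    · rintro ⟨b, rfl⟩
      exact ⟨_, ⟨(0, Sum.elim b 0), rfl⟩, funext fun a => hval _ a⟩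
  rw [himage, Nat.card_range_of_injective hG]
  simp

lemma sum_coe_eq_sum_dite {ι R : Type*} [Fintype ι] [DecidableEq ι] [CommSemiring R]
    (K : Finset ι) (b : K → R) (g : ι → R) :
    ∑ i : K, b i * g i = ∑ i, (if h : i ∈ K then b ⟨i, h⟩ else 0) * g i := by
  rw [← Finset.sum_subset (Finset.subset_univ K) (fun i _ hi => by simp [hi]),
    ← Finset.sum_coe_sort K fun i => (if h : i ∈ K then b ⟨i, h⟩ else 0) * g i]
  exact Finset.sum_congr rfl fun i _ => by simp

/-- The functions `2xᵢ`, `2πᵢ` for `i ∈ K` and `πᵢ - xᵢ` for `i ∈ F`, where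
`π = pointMove t K F`, are linearly independent over `Z₂`. -/
lemma eq_zero_of_sum_pointMove {m : ℕ} {t : Fin m → Fin m} (ht : ∀ i, t i ≠ i)
    {K F : Finset (Fin m)} (hKF : Disjoint K F) (a : Fin m → Z2) (b : K → Z2) (d : F → Z2)
    (h : ∀ x : Fin m → Z4, x + x ≠ 0 → ∑ i, ((a i).val : Z4) * (2 * x i) +
      ∑ i : K, ((b i).val : Z4) * (2 * pointMove t K F x i) +
      ∑ i : F, ((d i).val : Z4) * (pointMove t K F x i - x i) = 0) :
    a = 0 ∧ b = 0 ∧ d = 0 := by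
  classical
  let B : Fin m → Z4 := fun i => if h : i ∈ K then ((b ⟨i, h⟩).val : Z4) else 0
  let D : Fin m → Z4 := fun i => if h : i ∈ F then ((d ⟨i, h⟩).val : Z4) else 0
  let L : Fin m → Z4 := fun i => 2 * ((a i).val + B i)
  have hQ : ∀ x : Fin m → Z4, x + x ≠ 0 →
      ∑ i, L i * x i + ∑ i, (2 * B i + D i) * (pointMove t K F x i - x i) = 0 := by
    intro x hx
    have := h x hx
    rw [sum_coe_eq_sum_dite K (fun i => ((b i).val : Z4)) (fun i => 2 * pointMove t K F x i),
      sum_coe_eq_sum_dite F (fun i => ((d i).val : Z4)) (fun i => pointMove t K F x i - x i),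
      ← Finset.sum_add_distrib, ← Finset.sum_add_distrib] at this
    rw [← this, ← Finset.sum_add_distrib]
    refine Finset.sum_congr rfl fun i _ => ?_
    simp only [L, B, D]
    ring
  have hfix : ∀ c, labelMove K F c = c →
      L c.1 * (specialEntries c.2.1 c.2.2 (c.1 < t c.1)).1 +
        L (t c.1) * (specialEntries c.2.1 c.2.2 (c.1 < t c.1)).2 = 0 := by
    intro c hc
    have := hQ (specialPoint t c) (specialPoint_add_self_ne_zero ht c)
    rw [pointMove_specialPoint ht, hc, sum_mul_specialPoint] at this
    simpa using this
  have hL : ∀ i, L i = 0 := by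
    have key0 : ∀ b, specialEntries 0 false b = (2, 1) := by decide
    have key1 : ∀ b, ∀ x : Z4, x * (specialEntries 1 false b).1 + 0 = 0 → x = 0 := by decide
    have key2 : ∀ b, specialEntries 2 false b = (1, 0) := by decide
    have hL2 : ∀ i, L i * 2 = 0 := by
      have key : ∀ x : Z4, 2 * x * 2 = 0 := by decide
      exact fun i => key _
    intro i
    by_cases hF : i ∈ F
    · have hK : i ∉ K := Finset.disjoint_right.1 hKF hF
      have h0 := hfix (i, 0, false) (by simp [labelMove, hK])
      have h1 := hfix (i, 1, false) (by simp [labelMove, hK])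
      simp only [key0, hL2, zero_add, mul_one] at h0
      simp only [h0, zero_mul] at h1
      exact key1 _ _ h1
    · have h2 := hfix (i, 2, false) (by simp [labelMove, hF])
      simpa [key2] using h2
  have hdiff : ∀ x : Fin m → Z4, x + x ≠ 0 →
      ∑ i, (2 * B i + D i) * (pointMove t K F x i - x i) = 0 := by
    intro x hx
    simpa [hL] using hQ x hx
  have hb : ∀ i (hi : i ∈ K), b ⟨i, hi⟩ = 0 := by
    intro i hi
    have hF : i ∉ F := Finset.disjoint_left.1 hKF hi
    have := hdiff (specialPoint t (i, 0, false)) (specialPoint_add_self_ne_zero ht _)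
    simp only [mul_sub, Finset.sum_sub_distrib] at this
    have hmove : labelMove K F (i, 0, false) = (i, 1, false) := by simp [labelMove, hi]
    rw [pointMove_specialPoint ht, hmove, sum_mul_specialPoint, sum_mul_specialPoint] at this
    simp only [D, B, hi, hF, dif_pos, dif_neg, not_false_eq_true] at this
    generalize decide (i < t i) = lt at this
    have key : ∀ (x : Z2) (c : Z4) (lt : Bool),
      (2 * (x.val : Z4) + 0) * (specialEntries 1 false lt).1 +
        c * (specialEntries 1 false lt).2 -
        ((2 * (x.val : Z4) + 0) * (specialEntries 0 false lt).1 +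
        c * (specialEntries 0 false lt).2) = 0 → x = 0 := by decide
    exact key _ _ _ this
  have hB : ∀ i, B i = 0 := by
    intro i
    by_cases hi : i ∈ K
    · simp [B, hi, hb i hi]
    · simp [B, hi]
  have hd : ∀ i (hi : i ∈ F), d ⟨i, hi⟩ = 0 := by
    intro i hi
    have hK : i ∉ K := Finset.disjoint_right.1 hKF hi
    have := hdiff (specialPoint t (i, 2, false)) (specialPoint_add_self_ne_zero ht _)
    simp only [mul_sub, Finset.sum_sub_distrib] at this
    have hmove : labelMove K F (i, 2, false) = (i, 2, true) := by simp [labelMove, hi, hK]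
    rw [pointMove_specialPoint ht, hmove, sum_mul_specialPoint, sum_mul_specialPoint] at this
    simp only [hB, D, hi, dif_pos] at this
    generalize decide (i < t i) = lt at this
    have key : ∀ (x : Z2) (c : Z4) (lt : Bool),
      (2 * 0 + (x.val : Z4)) * (specialEntries 2 true lt).1 +
        c * (specialEntries 2 true lt).2 -
        ((2 * 0 + (x.val : Z4)) * (specialEntries 2 false lt).1 +
        c * (specialEntries 2 false lt).2) = 0 → x = 0 := by decide
    exact key _ _ _ this
  refine ⟨funext fun i => ?_, funext fun i => hb i i.2, funext fun i => hd i i.2⟩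
  have hLi := hL i
  have key : ∀ x : Z2, 2 * ((x.val : Z4) + 0) = 0 → x = 0 := by decide
  simp only [L, hB] at hLi
  exact key _ hLi

/-- The type of the sum of the code of a column system and of its image under
`binaryMove S` and `pointMove t K F`. -/
lemma IsColumnSystem.isOfTypeK_sup {α β n : ℕ} {y : Fin α → Fin (n + 2) → Z2}
    {r : Fin β → Fin (n + 2) → Z4} (h : IsColumnSystem y r) {t : Fin (n + 2) → Fin (n + 2)}
    (ht : ∀ i, t i ≠ i) {K F S : Finset (Fin (n + 2))} (hKF : Disjoint K F)
    (hSK : Disjoint S K) (hSF : Disjoint S F) :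
    isOfTypeK (hadamardCode y r ⊔
      hadamardCode (fun a => binaryMove S (y a)) fun j => pointMove t K F (r j))
        (S.card + 1 + F.card) (n + 2 + K.card) (S.card + 1) := by
  set X := coordWord y r with hX
  set Y := coordWord (fun a => binaryMove S (y a)) (fun j => pointMove t K F (r j)) with hY
  let w : Fin (n + 2) ⊕ K → Amb α β := Sum.elim X fun i => Y i
  let z : Option S ⊕ F → Amb α β :=
    Sum.elim (fun o => o.elim (allTwo α β) fun i => Y i - X i) fun i => Y i - X i
  have hfst : ∀ i a, (Y i - X i).1 a = if i ∈ S then shiftForm (y a) i else 0 := by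
    intro i a
    simp [hX, hY, coordWord, binaryMove]
  have hsnd : ∀ i j, (Y i - X i).2 j = pointMove t K F (r j) i - r j i := fun i j => rfl
  have htwo : ∀ i ∉ K, 2 • (Y i - X i) = 0 := by
    intro i hi
    have h2 : ∀ x : Z2, 2 • x = 0 := by decide
    refine Prod.ext (funext fun a => h2 _) (funext fun j => ?_)
    have := two_mul_pointMove_sub (F := F) ht hi (r j)
    rw [← hsnd] at this
    simpa [two_mul, two_nsmul] using this
  have hz : ∀ b, 2 • z b = 0 := by
    rintro ((_ | i) | i)
    · exact two_nsmul_allTwo α β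
    · exact htwo i (Finset.disjoint_left.1 hSK i.2)
    · exact htwo i (Finset.disjoint_right.1 hKF i.2)
  have hzfst : ∀ b, (z (Sum.inr b)).1 = 0 := by
    intro i
    funext a
    refine (hfst i a).trans (if_neg (Finset.disjoint_right.1 hSF i.2))
  have hind : ∀ b : Option S → Z2, (∀ a, ∑ j, b j * (z (Sum.inl j)).1 a = 0) → b = 0 := by
    intro b hb
    have := eq_zero_of_add_sum_shiftForm (b none) (fun i => b (some i)) (fun v => by
      obtain ⟨a, rfl⟩ := h.bijective.2 v
      rw [← hb a, Fintype.sum_option]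
      congr 1
      · simp [z, allTwo]
      · refine Finset.sum_congr rfl fun i _ => ?_
        congr 1
        exact ((hfst i a).trans (if_pos i.2)).symm)
    funext o
    cases o with
    | none => exact this.1
    | some i => exact this.2 i
  have hinj : Function.Injective (torsionHom w z hz) := by
    rw [injective_iff_map_eq_zero]
    rintro ⟨c₁, c₂⟩ hc
    have hc₂ : (fun o => c₂ (Sum.inl o)) = 0 := by
      apply hind
      intro a
      have := torsionHom_fst (w := w) hz (c₁, c₂) a
      rw [hc, Fintype.sum_sum_type] at this
      simpa [hzfst] using this.symm
    have hc₂' : ∀ o, c₂ (Sum.inl o) = 0 := congrFun hc₂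
    have hQ : ∀ j, ∑ i, ((c₁ (Sum.inl i)).val : Z4) * (2 * r j i) +
        ∑ i : K, ((c₁ (Sum.inr i)).val : Z4) * (2 * pointMove t K F (r j) i) +
        ∑ i : F, ((c₂ (Sum.inr i)).val : Z4) * (pointMove t K F (r j) i - r j i) = 0 := by
      intro j
      have := torsionHom_snd (w := w) hz (c₁, c₂) j
      rw [hc, Fintype.sum_sum_type, Fintype.sum_sum_type] at this
      simp only [hc₂', ZMod.val_zero, Nat.cast_zero, zero_mul, Finset.sum_const_zero,
        zero_add] at this
      exact this.symm
    have := eq_zero_of_sum_pointMove ht hKF (fun i => c₁ (Sum.inl i)) (fun i => c₁ (Sum.inr i))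
      (fun i => c₂ (Sum.inr i)) (fun x hx => by
        obtain ⟨j, hj⟩ := h.exists_eq_or_neg x hx
        have hQj := hQ j
        rcases hj with hj | hj
        · rwa [hj] at hQj
        · rw [← neg_eq_zero, ← hQj, hj, pointMove_neg ht]
          simp only [neg_add, ← Finset.sum_neg_distrib, Pi.neg_apply]
          congr 1
          · congr 1
            · exact Finset.sum_congr rfl fun i _ => by ring
            · exact Finset.sum_congr rfl fun i _ => by ring
          · exact Finset.sum_congr rfl fun i _ => by ring)
    refine Prod.ext (funext ?_) (funext ?_)
    · rintro (i | i)
      · exact congrFun this.1 i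
      · exact congrFun this.2.1 i
    · rintro (i | i)
      · exact hc₂' i
      · exact congrFun this.2.2 i
  have hspan : AddSubgroup.closure (Set.range w ∪ Set.range z) = hadamardCode y r ⊔
      hadamardCode (fun a => binaryMove S (y a)) fun j => pointMove t K F (r j) := by
    have hXmem : ∀ i, X i ∈ hadamardCode y r := fun i =>
      AddSubgroup.subset_closure (Or.inl ⟨i, rfl⟩)
    have hYmem : ∀ i, Y i ∈ hadamardCode (fun a => binaryMove S (y a))
        fun j => pointMove t K F (r j) := fun i =>
      AddSubgroup.subset_closure (Or.inl ⟨i, rfl⟩)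
    apply le_antisymm
    · rw [AddSubgroup.closure_le]
      have hX' := fun i => AddSubgroup.mem_sup_left
        (T := hadamardCode (fun a => binaryMove S (y a)) fun j => pointMove t K F (r j)) (hXmem i)
      have hY' := fun i => AddSubgroup.mem_sup_right (S := hadamardCode y r) (hYmem i)
      rintro _ (⟨i | i, rfl⟩ | ⟨(_ | i) | i, rfl⟩)
      · exact hX' i
      · exact hY' i
      · exact AddSubgroup.mem_sup_left (AddSubgroup.subset_closure (Or.inr ⟨(), rfl⟩))
      · exact sub_mem (hY' i) (hX' i)
      · exact sub_mem (hY' i) (hX' i)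
    · have hw : ∀ i, w i ∈ AddSubgroup.closure (Set.range w ∪ Set.range z) := fun i =>
        AddSubgroup.subset_closure (Or.inl ⟨i, rfl⟩)
      have hz' : ∀ i, z i ∈ AddSubgroup.closure (Set.range w ∪ Set.range z) := fun i =>
        AddSubgroup.subset_closure (Or.inr ⟨i, rfl⟩)
      refine sup_le ?_ ?_ <;> rw [hadamardCode, AddSubgroup.closure_le]
      · rintro _ (⟨i, rfl⟩ | ⟨_, rfl⟩)
        · exact hw (Sum.inl i)
        · exact hz' (Sum.inl none)
      · rintro _ (⟨i, rfl⟩ | ⟨_, rfl⟩)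
        · by_cases hK : i ∈ K
          · exact hw (Sum.inr ⟨i, hK⟩)
          have hsub : Y i - X i ∈ AddSubgroup.closure (Set.range w ∪ Set.range z) := by
            by_cases hS : i ∈ S
            · exact hz' (Sum.inl (some ⟨i, hS⟩))
            by_cases hF : i ∈ F
            · exact hz' (Sum.inr ⟨i, hF⟩)
            have : Y i - X i = 0 := by
              refine Prod.ext (funext fun a => ?_) (funext fun j => ?_)
              · exact (hfst i a).trans (if_neg hS)
              · rw [hsnd, pointMove_apply_of_notMem ht hK hF, sub_self]
                rfl
            rw [this]
            exact zero_mem _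
          have := add_mem hsub (hw (Sum.inl i))
          rwa [show w (Sum.inl i) = X i from rfl, sub_add_cancel] at this
        · exact hz' (Sum.inl none)
  rw [← hspan]
  refine ⟨?_, ?_⟩
  · have := isOfType_closure hz hinj
    simpa only [Fintype.card_sum, Fintype.card_option, Fintype.card_coe, Fintype.card_fin]
      using this
  · have := card_fst_torsion hz hinj hzfst hind
    simpa only [Fintype.card_option, Fintype.card_coe] using this

lemma exists_disjoint_finsets {m k f s : ℕ} [NeZero m] (h : k + f + s ≤ m) :
    ∃ K F S : Finset (Fin m), Disjoint K F ∧ Disjoint S K ∧ Disjoint S F ∧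
      (0 ∈ S → S = Finset.univ) ∧ K.card = k ∧ F.card = f ∧ S.card = s := by
  classical
  obtain ⟨S, hS, hs⟩ : ∃ S : Finset (Fin m), (0 ∈ S → S = Finset.univ) ∧ S.card = s := by
    rcases (show s ≤ m by omega).eq_or_lt with rfl | hlt
    · exact ⟨Finset.univ, fun _ => rfl, by simp⟩
    · obtain ⟨S, hS, hs⟩ := Finset.exists_subset_card_eq
        (s := Finset.univ.erase (0 : Fin m)) (n := s) (by simp; omega)
      exact ⟨S, fun h0 => absurd (hS h0) (by simp), hs⟩
  obtain ⟨F, hF, hf⟩ := Finset.exists_subset_card_eq (s := Sᶜ) (n := f) (by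
    rw [Finset.card_compl, Fintype.card_fin]; omega)
  obtain ⟨K, hK, hk⟩ := Finset.exists_subset_card_eq (s := Sᶜ \ F) (n := k) (by
    rw [Finset.card_sdiff_of_subset hF, Finset.card_compl, Fintype.card_fin]; omega)
  refine ⟨K, F, S, ?_, ?_, ?_, hS, hk, hf, hs⟩
  · exact Finset.disjoint_left.2 fun i hi => (Finset.mem_sdiff.1 (hK hi)).2
  · exact Finset.disjoint_right.2 fun i hi =>
      Finset.mem_compl.1 (Finset.mem_sdiff.1 (hK hi)).1
  · exact Finset.disjoint_right.2 fun i hi => Finset.mem_compl.1 (hF hi)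

/-- for `m ≥ 2`, all admissible dual types `(2^m,2^(2m-1)-2^(m-1);γ,δ;κ)`
with `m ≤ δ ≤ 2m` and `1 ≤ κ ≤ γ ≤ 2m-δ+1` (the latter bound stated equivalently as
`γ + δ ≤ 2m + 1`) are attained by intersections of two additive extended perfect codes
of dual type `(2^m,2^(2m-1)-2^(m-1);1,m)`. -/
theorem stmt16 {m γ δ κ : ℕ} (hm : 2 ≤ m) (hδ₁ : m ≤ δ) (hδ₂ : δ ≤ 2 * m)
    (hκ₁ : 1 ≤ κ) (hκγ : κ ≤ γ) (hγ : γ + δ ≤ 2 * m + 1) :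
    ∃ C₁ C₂ : AddSubgroup (Amb (2 ^ m) (2 ^ (2 * m - 1) - 2 ^ (m - 1))),
      isAddExtPerfect (2 * m) (2 ^ m) (2 ^ (2 * m - 1) - 2 ^ (m - 1)) C₁ ∧
      isAddExtPerfect (2 * m) (2 ^ m) (2 ^ (2 * m - 1) - 2 ^ (m - 1)) C₂ ∧
      isOfType (dualCode C₁) 1 m ∧ isOfType (dualCode C₂) 1 m ∧
      isOfTypeK (dualCode (C₁ ⊓ C₂)) γ δ κ := by
  obtain ⟨n, rfl⟩ : ∃ n, m = n + 2 := ⟨m - 2, by omega⟩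
  obtain ⟨y, r, h⟩ := exists_isColumnSystem (m := n + 2) (by omega)
  obtain ⟨K, F, S, hKF, hSK, hSF, hS, hk, hf, hs⟩ := exists_disjoint_finsets (m := n + 2)
    (k := δ - (n + 2)) (f := γ - κ) (s := κ - 1) (by omega)
  have ht : ∀ i : Fin (n + 2), (if i = 0 then 1 else 0) ≠ i := by
    intro i
    split_ifs with hi
    · simp [hi]
    · exact Ne.symm hi
  have h' := h.move ht (K := K) (F := F) hS
  have hlen : 2 ^ (n + 2) + 2 * (2 ^ (2 * (n + 2) - 1) - 2 ^ (n + 2 - 1)) =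
      2 ^ (2 * (n + 2)) := by
    have e1 : 2 ^ (n + 2) = 2 * 2 ^ (n + 1) := by ring
    have e2 : 2 ^ (2 * (n + 2)) = 2 * 2 ^ (2 * n + 3) := by ring
    have e3 : 2 ^ (n + 1) ≤ 2 ^ (2 * n + 3) := Nat.pow_le_pow_right two_pos (by omega)
    rw [show 2 * (n + 2) - 1 = 2 * n + 3 by omega, show n + 2 - 1 = n + 1 by omega]
    omega
  refine ⟨_, _, h.isAddExtPerfect_dualCode hm Nat.one_le_two_pow hlen,
    h'.isAddExtPerfect_dualCode hm Nat.one_le_two_pow hlen, ?_, ?_, ?_⟩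
  · rw [dualCode_dualCode]
    exact h.isOfType_hadamardCode
  · rw [dualCode_dualCode]
    exact h'.isOfType_hadamardCode
  · rw [← dualCode_sup, dualCode_dualCode]
    have hT := h.isOfTypeK_sup ht hKF hSK hSF
    rw [hk, hf, hs] at hT
    rwa [show κ - 1 + 1 + (γ - κ) = γ by omega, show n + 2 + (δ - (n + 2)) = δ by omega,
      show κ - 1 + 1 = κ by omega] at hT
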